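/- Let w̃₂ ∈ W̃₁, let α be a simple root, and let ω ∈ X be such that (s_α w̃₂)^⋄ = t_ω s_α w̃₂ ∈ W̃₁. Then ℓ((s_α w̃₂)^⋄) = ℓ(w̃₂) + Σ_{β∈R⁺} ⟨ω,β∨⟩ − 1. -/

import Mathlib

open scoped Classical Pointwise

namespace SerrePaper

variable (V : Type) [AddCommGroup V] [Module ℝ V]

/-- The combinatorial context of the paper: the character lattice `X` of a split maximal
torus, sitting inside the real vector space `V = X ⊗ ℝ`, together with a reduced
crystallographic root system `R` with positive roots `Rpos`, simple roots `Δ`,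
the coroot pairing `coroot α = ⟨·, α∨⟩`, the weight `η` pairing to `1` with every simple
coroot, and the longest element `w0` of the Weyl group. -/
structure Ctx where
  R : Finset V
  Rpos : Finset V
  Δ : Finset V
  coroot : V → V →ₗ[ℝ] ℝ
  eta : V
  w0 : V ≃ₗ[ℝ] V
  X : AddSubgroup V
  pos_subset : Rpos ⊆ R
  simple_subset : Δ ⊆ Rpos
  root_ne_zero : ∀ α ∈ R, α ≠ (0 : V)
  neg_mem : ∀ α ∈ R, -α ∈ R
  pos_or_neg : ∀ α ∈ R, α ∈ Rpos ∨ -α ∈ Rpos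
  pos_not_neg : ∀ α ∈ Rpos, -α ∉ Rpos
  coroot_self : ∀ α ∈ R, coroot α α = 2
  coroot_neg : ∀ α ∈ R, coroot (-α) = -coroot α
  crystallographic : ∀ α ∈ R, ∀ β ∈ R, ∃ n : ℤ, coroot α β = (n : ℝ)
  reduced : ∀ α ∈ R, ∀ c : ℝ, c • α ∈ R → c = 1 ∨ c = -1
  reflect_root : ∀ α ∈ R, ∀ β ∈ R, β - coroot α β • α ∈ R
  reflect_coroot : ∀ α ∈ R, ∀ β ∈ R, ∀ x : V,
    coroot (β - coroot α β • α) x = coroot β x - coroot β α * coroot α x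
  pos_sum_simple : ∀ α ∈ Rpos, ∃ c : V → ℕ, α = ∑ β ∈ Δ, (c β : ℝ) • β
  simple_indep : LinearIndependent ℝ (fun β : {x // x ∈ Δ} => (β : V))
  eta_pair : ∀ α ∈ Δ, coroot α eta = 1
  root_mem_X : ∀ α ∈ R, α ∈ X
  eta_mem_X : eta ∈ X
  coroot_int : ∀ α ∈ R, ∀ x ∈ X, ∃ n : ℤ, coroot α x = (n : ℝ)
  w0_mem : w0 ∈ Subgroup.closure {g : V ≃ₗ[ℝ] V | ∃ α ∈ R, ∀ x, g x = x - coroot α x • α}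
  w0_neg : ∀ α ∈ Rpos, -(w0 α) ∈ Rpos

namespace Ctx

variable {V}
variable (S : Ctx V)

/-- The (finite) Weyl group, generated by the reflections `s_α`, `α ∈ R`. -/
def Weyl : Subgroup (V ≃ₗ[ℝ] V) :=
  Subgroup.closure {g : V ≃ₗ[ℝ] V | ∃ α ∈ S.R, ∀ x, g x = x - S.coroot α x • α}

/-- The translation `t_ν` as an affine automorphism of `V`. -/
def trans (_S : Ctx V) (ν : V) : V ≃ᵃ[ℝ] V := AffineEquiv.constVAdd ℝ V ν

/-- A linear automorphism viewed as an affine automorphism. -/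
def ofW (_S : Ctx V) (w : V ≃ₗ[ℝ] V) : V ≃ᵃ[ℝ] V := w.toAffineEquiv

/-- The extended affine Weyl group `W̃ = X ⋊ W`, realized as the set of affine
transformations of the form `t_ν ∘ w` with `ν ∈ X` and `w ∈ W`. -/
def extAff : Set (V ≃ᵃ[ℝ] V) :=
  {g | ∃ ν ∈ S.X, ∃ w ∈ S.Weyl, g = S.trans ν * S.ofW w}

/-- The base alcove `A₀`. -/
def A0 : Set V := {x | ∀ α ∈ S.Rpos, 0 < S.coroot α x ∧ S.coroot α x < 1}

/-- The affine hyperplane `⟨·,α∨⟩ = n` separates the base alcove `A₀` from its image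
`g(A₀)`. -/
def Separates (α : V) (n : ℤ) (g : V ≃ᵃ[ℝ] V) : Prop :=
  ((∀ x ∈ S.A0, S.coroot α x < (n : ℝ)) ∧ (∀ x ∈ S.A0, (n : ℝ) < S.coroot α (g x))) ∨
  ((∀ x ∈ S.A0, (n : ℝ) < S.coroot α x) ∧ (∀ x ∈ S.A0, S.coroot α (g x) < (n : ℝ)))

/-- The length `ℓ(g)` of an element of the extended affine Weyl group: the number of
affine root hyperplanes separating `A₀` from `g(A₀)`. -/
noncomputable def len (g : V ≃ᵃ[ℝ] V) : ℕ :=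
  Set.ncard {q : V × ℤ | q.1 ∈ S.Rpos ∧ S.Separates q.1 q.2 g}

/-- The set of affine reflections `s_{α,n} : x ↦ x - (⟨x,α∨⟩ - n)α`. -/
def affRefl : Set (V ≃ᵃ[ℝ] V) :=
  {g | ∃ α ∈ S.R, ∃ n : ℤ, ∀ x, g x = x - (S.coroot α x - (n : ℝ)) • α}

/-- The Bruhat order on the extended affine Weyl group, generated by
`u < r·u` for affine reflections `r` with `ℓ(u) < ℓ(r·u)` (this fixes the
`Ω`-component, so it is the componentwise extension of the Bruhat order on `W_a`). -/
def bruhatLE : (V ≃ᵃ[ℝ] V) → (V ≃ᵃ[ℝ] V) → Prop :=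
  Relation.ReflTransGen fun u w => (∃ r ∈ S.affRefl, w = r * u) ∧ S.len u < S.len w

/-- Jantzen's `↑`-order, transported to the (extended) affine Weyl group via
`w̃ ↦ w̃(A₀)`: generated by `u ↑ s_{α,n}·u` whenever `u(A₀)` lies below the hyperplane
`⟨·,α∨⟩ = n`.  (Under the affine rescaling `λ ↦ (λ+η)/p` this is equivalent to the usual
`↑`-order on `p`-alcoves, transported via the `p`-dot action `w̃ ↦ w̃ · C₀`.) -/
def upLE : (V ≃ᵃ[ℝ] V) → (V ≃ᵃ[ℝ] V) → Prop :=
  Relation.ReflTransGen fun u w =>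
    ∃ α ∈ S.Rpos, ∃ n : ℤ,
      (∀ x : V, w x = u x - (S.coroot α (u x) - (n : ℝ)) • α) ∧
      ∀ x ∈ S.A0, S.coroot α (u x) < (n : ℝ)

/-- `W̃⁺`: the elements of `W̃` taking the base alcove to a dominant alcove. -/
def Wplus : Set (V ≃ᵃ[ℝ] V) :=
  {g | g ∈ S.extAff ∧ ∀ x ∈ S.A0, ∀ α ∈ S.Δ, 0 < S.coroot α (g x)}

/-- `W̃₁`: the elements of `W̃` taking the base alcove to a restricted alcove. -/
def Wone : Set (V ≃ᵃ[ℝ] V) :=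
  {g | g ∈ S.extAff ∧ ∀ x ∈ S.A0, ∀ α ∈ S.Δ,
    0 < S.coroot α (g x) ∧ S.coroot α (g x) < 1}

/-- `w̃_h = w₀ t_{-η}`. -/
noncomputable def wh : V ≃ᵃ[ℝ] V := S.ofW S.w0 * S.trans (-S.eta)

/-- The lowest `p`-alcove `C₀`. -/
def C0 (p : ℕ) : Set V :=
  {x | ∀ α ∈ S.Rpos, 0 < S.coroot α (x + S.eta) ∧ S.coroot α (x + S.eta) < (p : ℝ)}

/-- The root lattice `ℤR`. -/
def rootLattice : AddSubgroup V := AddSubgroup.closure (S.R : Set V)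

/-- `Ω`: the stabilizer of the base alcove in `W̃`. -/
def Omega : Set (V ≃ᵃ[ℝ] V) := {g | g ∈ S.extAff ∧ g '' S.A0 = S.A0}

/-- The `λ`-admissible set `Adm(λ) = ⋃_{w ∈ W} W̃_{≤ t_{w(λ)}}`. -/
def Adm (lam : V) : Set (V ≃ᵃ[ℝ] V) :=
  {g | ∃ w ∈ S.Weyl, S.bruhatLE g (S.trans (w lam))}

/-- `α∨` is a highest coroot, i.e. the highest root of an irreducible component of the
dual root system `R∨`: equivalently, `α∨` is a dominant coroot and no simple coroot can
be added to `α∨` to yield a coroot. -/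
def IsHighestCoroot (α : V) : Prop :=
  α ∈ S.R ∧ (∀ β ∈ S.Δ, 0 ≤ S.coroot α β) ∧
    ∀ β ∈ S.Δ, ∀ γ ∈ S.R, S.coroot γ ≠ S.coroot α + S.coroot β

end Ctx


namespace Ctx

variable {V} (S : Ctx V)

lemma simple_mem_R {α : V} (hα : α ∈ S.Δ) : α ∈ S.R :=
  S.pos_subset (S.simple_subset hα)

lemma exists_functional (φ : V → ℝ) : ∃ f : V →ₗ[ℝ] ℝ, ∀ δ ∈ S.Δ, f δ = φ δ := by
  let b := Module.Basis.span S.simple_indep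
  obtain ⟨f, hf⟩ := (b.constr ℝ fun δ => φ δ).exists_extend
  refine ⟨f, fun δ hδ => ?_⟩
  have h1 : (b ⟨δ, hδ⟩ : V) = δ :=
    congrArg Subtype.val (Module.Basis.span_apply S.simple_indep ⟨δ, hδ⟩)
  have h2 := LinearMap.congr_fun hf (b ⟨δ, hδ⟩)
  rw [Module.Basis.constr_basis, LinearMap.comp_apply, Submodule.subtype_apply, h1] at h2
  exact h2

/-- Reflecting in a root is an involution on roots. -/
lemma reflect_reflect {α : V} (hα : α ∈ S.R) (β : V) :
    (β - S.coroot α β • α) - S.coroot α (β - S.coroot α β • α) • α = β := by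
  simp only [map_sub, map_smul, S.coroot_self α hα, smul_eq_mul]
  module

/-- The bilinear form `∑ γ, ⟨x,γ∨⟩⟨y,γ∨⟩` is invariant under reflections. -/
lemma sum_coroot_mul_reflect {α : V} (hα : α ∈ S.R) (x y : V) :
    ∑ γ ∈ S.R, S.coroot γ (x - S.coroot α x • α) * S.coroot γ (y - S.coroot α y • α) =
      ∑ γ ∈ S.R, S.coroot γ x * S.coroot γ y := by
  refine Finset.sum_bij' (fun γ _ => γ - S.coroot α γ • α) (fun γ _ => γ - S.coroot α γ • α)
    (fun γ hγ => S.reflect_root α hα γ hγ) (fun γ hγ => S.reflect_root α hα γ hγ)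
    (fun γ _ => S.reflect_reflect hα γ) (fun γ _ => S.reflect_reflect hα γ) fun γ hγ => ?_
  rw [S.reflect_coroot α hα γ hγ, S.reflect_coroot α hα γ hγ]
  simp only [map_sub, map_smul, smul_eq_mul]
  ring

lemma coroot_mul_sum_sq {α : V} (hα : α ∈ S.R) (y : V) :
    S.coroot α y * ∑ γ ∈ S.R, S.coroot γ α * S.coroot γ α =
      2 * ∑ γ ∈ S.R, S.coroot γ α * S.coroot γ y := by
  have h := S.sum_coroot_mul_reflect hα α y
  simp only [map_sub, map_smul, S.coroot_self α hα, smul_eq_mul] at h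
  have h2 : ∑ γ ∈ S.R, (S.coroot γ α - 2 * S.coroot γ α) *
      (S.coroot γ y - S.coroot α y * S.coroot γ α) =
      S.coroot α y * ∑ γ ∈ S.R, S.coroot γ α * S.coroot γ α -
        ∑ γ ∈ S.R, S.coroot γ α * S.coroot γ y := by
    rw [Finset.mul_sum, ← Finset.sum_sub_distrib]
    exact Finset.sum_congr rfl fun γ _ => by ring
  linarith

lemma sum_sq_pos {α : V} (hα : α ∈ S.R) :
    0 < ∑ γ ∈ S.R, S.coroot γ α * S.coroot γ α :=
  Finset.sum_pos' (fun _ _ => mul_self_nonneg _) ⟨α, hα, by rw [S.coroot_self α hα]; norm_num⟩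

lemma coroot_pos_symm {α β : V} (hα : α ∈ S.R) (hβ : β ∈ S.R) (h : 0 < S.coroot β α) :
    0 < S.coroot α β := by
  have h1 := S.coroot_mul_sum_sq hα β
  have h2 := S.coroot_mul_sum_sq hβ α
  have h3 : ∑ γ ∈ S.R, S.coroot γ α * S.coroot γ β = ∑ γ ∈ S.R, S.coroot γ β * S.coroot γ α :=
    Finset.sum_congr rfl fun γ _ => mul_comm _ _
  have h4 := mul_pos h (S.sum_sq_pos hβ)
  exact pos_of_mul_pos_left (by rw [h1, h3, ← h2]; exact h4) (S.sum_sq_pos hα).le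

/-- A simple reflection permutes the positive roots other than the simple root itself. -/
lemma reflect_mem_Rpos {α β : V} (hα : α ∈ S.Δ) (hβ : β ∈ S.Rpos) (hne : β ≠ α) :
    β - S.coroot α β • α ∈ S.Rpos := by
  have hmem := S.reflect_root α (S.simple_mem_R hα) β (S.pos_subset hβ)
  refine (S.pos_or_neg _ hmem).resolve_right fun hneg => hne ?_
  obtain ⟨c, hc⟩ := S.pos_sum_simple β hβ
  obtain ⟨d, hd⟩ := S.pos_sum_simple _ hneg
  obtain ⟨f, hf⟩ := S.exists_functional fun δ => if δ = α then 0 else 1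
  have hfsum (e : V → ℕ) : f (∑ γ ∈ S.Δ, (e γ : ℝ) • γ) =
      ∑ γ ∈ S.Δ, (e γ : ℝ) * (if γ = α then 0 else 1) := by
    rw [map_sum]
    exact Finset.sum_congr rfl fun γ hγ => by rw [map_smul, hf γ hγ, smul_eq_mul]
  have hterm (e : V → ℕ) : ∀ γ ∈ S.Δ, 0 ≤ (e γ : ℝ) * (if γ = α then 0 else 1) := by
    intro γ _
    split_ifs <;> simp
  have h1 : f β = ∑ γ ∈ S.Δ, (c γ : ℝ) * (if γ = α then 0 else 1) := by
    conv_lhs => rw [hc]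
    exact hfsum c
  have h2 : f (-(β - S.coroot α β • α)) = -f β := by
    simp [hf α hα]
  have h3 : 0 ≤ -f β := by
    rw [← h2, hd, hfsum]
    exact Finset.sum_nonneg (hterm d)
  have h4 : ∑ γ ∈ S.Δ, (c γ : ℝ) * (if γ = α then 0 else 1) = 0 :=
    le_antisymm (by linarith) (Finset.sum_nonneg (hterm c))
  rw [Finset.sum_eq_zero_iff_of_nonneg (hterm c)] at h4
  have h5 : β = (c α : ℝ) • α := by
    conv_lhs => rw [hc]
    refine Finset.sum_eq_single_of_mem α hα fun γ hγ hγα => ?_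
    have := h4 γ hγ
    rw [if_neg hγα, mul_one] at this
    rw [this, zero_smul]
  rcases S.reduced α (S.simple_mem_R hα) (c α) (h5 ▸ S.pos_subset hβ) with h | h
  · rw [h5, h, one_smul]
  · have : (0 : ℝ) ≤ c α := Nat.cast_nonneg _
    linarith

/-- A vector pairing positively with the simple coroots pairs positively with all positive
coroots. -/
lemma coroot_pos_of_simple {x : V} (hx : ∀ α ∈ S.Δ, 0 < S.coroot α x) {β : V}
    (hβ : β ∈ S.Rpos) : 0 < S.coroot β x := by
  obtain ⟨ht, hht⟩ := S.exists_functional fun _ => 1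
  have key : ∀ n : ℕ, ∀ β ∈ S.Rpos, ht β < n → 0 < S.coroot β x := by
    intro n
    induction n with
    | zero =>
      intro β hβ hlt
      obtain ⟨c, hc⟩ := S.pos_sum_simple β hβ
      rw [hc, map_sum] at hlt
      refine absurd hlt (not_lt.2 ?_)
      rw [Nat.cast_zero]
      refine Finset.sum_nonneg fun γ hγ => ?_
      rw [map_smul, hht γ hγ]
      simp
    | succ n ih =>
      intro β hβ hlt
      by_cases hs : β ∈ S.Δ
      · exact hx β hs
      have hβR := S.pos_subset hβ
      obtain ⟨α, hα, hpos⟩ : ∃ α ∈ S.Δ, 0 < S.coroot β α := by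
        by_contra! hcon
        obtain ⟨c, hc⟩ := S.pos_sum_simple β hβ
        have h1 := S.coroot_self β hβR
        have h2 : S.coroot β β = ∑ γ ∈ S.Δ, (c γ : ℝ) * S.coroot β γ := by
          conv_lhs => rw [show S.coroot β β = S.coroot β (∑ γ ∈ S.Δ, (c γ : ℝ) • γ) from
            congrArg _ hc, map_sum]
          simp
        have h3 : ∑ γ ∈ S.Δ, (c γ : ℝ) * S.coroot β γ ≤ 0 := Finset.sum_nonpos fun γ hγ =>
          mul_nonpos_of_nonneg_of_nonpos (Nat.cast_nonneg _) (hcon γ hγ)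
        linarith
      have hαR := S.simple_mem_R hα
      have hpos' := S.coroot_pos_symm hαR hβR hpos
      have hone : 1 ≤ S.coroot α β := by
        obtain ⟨k, hk⟩ := S.crystallographic α hαR β hβR
        rw [hk] at hpos' ⊢
        have : 0 < k := by exact_mod_cast hpos'
        exact_mod_cast this
      have hmem := S.reflect_mem_Rpos hα hβ (fun h => hs (h ▸ hα))
      have h := ih _ hmem (by
        rw [map_sub, map_smul, hht α hα, smul_eq_mul]
        push_cast at hlt
        linarith)
      rw [S.reflect_coroot α hαR β hβR] at h
      have := mul_pos hpos (hx α hα)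
      linarith
  obtain ⟨n, hn⟩ := exists_nat_gt (ht β)
  exact key n β hβ hn

lemma A0_nonempty : S.A0.Nonempty := by
  have hpos : ∀ β ∈ S.Rpos, 0 < S.coroot β S.eta := fun β hβ =>
    S.coroot_pos_of_simple (fun α hα => by rw [S.eta_pair α hα]; exact one_pos) hβ
  have hsum : 0 ≤ ∑ β ∈ S.Rpos, S.coroot β S.eta := Finset.sum_nonneg fun β hβ => (hpos β hβ).le
  refine ⟨(1 + ∑ β ∈ S.Rpos, S.coroot β S.eta)⁻¹ • S.eta, fun β hβ => ?_⟩
  have hle : S.coroot β S.eta ≤ ∑ β ∈ S.Rpos, S.coroot β S.eta :=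
    Finset.single_le_sum (f := fun β => S.coroot β S.eta) (fun γ hγ => (hpos γ hγ).le) hβ
  rw [map_smul, smul_eq_mul]
  have hN : 0 < 1 + ∑ β ∈ S.Rpos, S.coroot β S.eta := by linarith
  refine ⟨mul_pos (inv_pos.2 hN) (hpos β hβ), ?_⟩
  rw [inv_mul_lt_iff₀ hN]
  linarith

/-- The Weyl group permutes the coroots. -/
lemma exists_coroot_comp {w : V ≃ₗ[ℝ] V} (hw : w ∈ S.Weyl) {β : V} (hβ : β ∈ S.R) :
    ∃ γ ∈ S.R, ∀ x, S.coroot β (w x) = S.coroot γ x := by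
  suffices h : (∀ β ∈ S.R, ∃ γ ∈ S.R, ∀ x, S.coroot β (w x) = S.coroot γ x) ∧
      (∀ β ∈ S.R, ∃ γ ∈ S.R, ∀ x, S.coroot β (w⁻¹ x) = S.coroot γ x) from h.1 β hβ
  unfold Weyl at hw
  induction hw using Subgroup.closure_induction with
  | mem g hg =>
    obtain ⟨α, hα, hg⟩ := hg
    have hinv : g⁻¹ = g := by
      rw [inv_eq_iff_mul_eq_one]
      ext x
      rw [LinearEquiv.mul_apply, hg (g x), hg x, S.reflect_reflect hα]
      rfl
    have h : ∀ β ∈ S.R, ∃ γ ∈ S.R, ∀ x, S.coroot β (g x) = S.coroot γ x := fun β hβ =>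
      ⟨_, S.reflect_root α hα β hβ, fun x => by
        rw [S.reflect_coroot α hα β hβ, hg, map_sub, map_smul, smul_eq_mul, mul_comm]⟩
    exact ⟨h, by rwa [hinv]⟩
  | one => exact ⟨fun β hβ => ⟨β, hβ, fun _ => rfl⟩, fun β hβ => ⟨β, hβ, fun x => by simp⟩⟩
  | mul g h _ _ ihg ihh =>
    refine ⟨fun β hβ => ?_, fun β hβ => ?_⟩
    · obtain ⟨γ, hγ, h1⟩ := ihg.1 β hβ
      obtain ⟨δ, hδ, h2⟩ := ihh.1 γ hγ
      exact ⟨δ, hδ, fun x => by rw [LinearEquiv.mul_apply, h1, h2]⟩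
    · obtain ⟨γ, hγ, h1⟩ := ihh.2 β hβ
      obtain ⟨δ, hδ, h2⟩ := ihg.2 γ hγ
      exact ⟨δ, hδ, fun x => by rw [mul_inv_rev, LinearEquiv.mul_apply, h1, h2]⟩
  | inv g _ ih => exact ⟨ih.2, by rw [inv_inv]; exact ih.1⟩

/-- No root hyperplane meets the alcove `g(A₀)`. -/
lemma exists_strip {g : V ≃ᵃ[ℝ] V} (hg : g ∈ S.extAff) {β : V} (hβ : β ∈ S.R) :
    ∃ n : ℤ, ∀ x ∈ S.A0, (n : ℝ) < S.coroot β (g x) ∧ S.coroot β (g x) < n + 1 := by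
  obtain ⟨ν, hν, w, hw, rfl⟩ := hg
  obtain ⟨m, hm⟩ := S.coroot_int β hβ ν hν
  obtain ⟨γ, hγ, h⟩ := S.exists_coroot_comp hw hβ
  have hval (x : V) : S.coroot β ((S.trans ν * S.ofW w) x) = m + S.coroot γ x := by
    rw [← hm, ← h x, ← map_add]
    rfl
  rcases S.pos_or_neg γ hγ with hp | hp
  · refine ⟨m, fun x hx => ?_⟩
    have := hx γ hp
    rw [hval]
    constructor <;> linarith
  · refine ⟨m - 1, fun x hx => ?_⟩
    have := hx (-γ) hp
    rw [S.coroot_neg γ hγ, LinearMap.neg_apply] at this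
    rw [hval]
    push_cast
    constructor <;> linarith

lemma floor_strip {g : V ≃ᵃ[ℝ] V} (hg : g ∈ S.extAff) {β x₀ : V} (hβ : β ∈ S.R)
    (hx₀ : x₀ ∈ S.A0) {x : V} (hx : x ∈ S.A0) :
    (⌊S.coroot β (g x₀)⌋ : ℝ) < S.coroot β (g x) ∧
      S.coroot β (g x) < ⌊S.coroot β (g x₀)⌋ + 1 := by
  obtain ⟨n, hn⟩ := S.exists_strip hg hβ
  have : ⌊S.coroot β (g x₀)⌋ = n := Int.floor_eq_iff.2 ⟨(hn x₀ hx₀).1.le, (hn x₀ hx₀).2⟩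
  rw [this]
  exact hn x hx

/-- The length of an element taking `A₀` to a dominant alcove. -/
lemma len_eq_sum_floor {g : V ≃ᵃ[ℝ] V} (hg : g ∈ S.Wplus) {x₀ : V} (hx₀ : x₀ ∈ S.A0) :
    (S.len g : ℤ) = ∑ β ∈ S.Rpos, ⌊S.coroot β (g x₀)⌋ := by
  have hdom : ∀ β ∈ S.Rpos, 0 < S.coroot β (g x₀) := fun β hβ =>
    S.coroot_pos_of_simple (hg.2 x₀ hx₀) hβ
  have hset : {q : V × ℤ | q.1 ∈ S.Rpos ∧ S.Separates q.1 q.2 g} =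
      ((S.Rpos.sigma fun β => Finset.Icc 1 ⌊S.coroot β (g x₀)⌋).map
        (Equiv.sigmaEquivProd V ℤ).toEmbedding : Finset (V × ℤ)) := by
    ext ⟨β, n⟩
    simp only [Set.mem_ofPred_eq, Finset.coe_map, Set.mem_image, Finset.mem_coe, Finset.mem_sigma,
      Finset.mem_Icc, Equiv.coe_toEmbedding]
    constructor
    · rintro ⟨hβ, h⟩
      refine ⟨⟨β, n⟩, ⟨hβ, ?_⟩, rfl⟩
      have hx := hx₀ β hβ
      rcases h with ⟨h1, h2⟩ | ⟨h1, h2⟩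
      · have h3 : (0 : ℝ) < n := hx.1.trans (h1 x₀ hx₀)
        have h4 : 0 < n := by exact_mod_cast h3
        exact ⟨h4, Int.le_floor.2 (h2 x₀ hx₀).le⟩
      · have h3 : (n : ℝ) < 1 := (h1 x₀ hx₀).trans hx.2
        have h4 : (0 : ℝ) < n := (hdom β hβ).trans (h2 x₀ hx₀)
        have h5 : n < 1 := by exact_mod_cast h3
        have h6 : 0 < n := by exact_mod_cast h4
        omega
    · rintro ⟨⟨β', n'⟩, ⟨hβ, h1, h2⟩, heq⟩
      obtain ⟨rfl, rfl⟩ := Prod.mk.inj heq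
      refine ⟨hβ, Or.inl ⟨fun x hx => (hx _ hβ).2.trans_le (by exact_mod_cast h1), fun x hx => ?_⟩⟩
      exact lt_of_le_of_lt (by exact_mod_cast h2)
        (S.floor_strip hg.1 (S.pos_subset hβ) hx₀ hx).1
  rw [len, hset, Set.ncard_coe_finset, Finset.card_map, Finset.card_sigma]
  push_cast
  refine Finset.sum_congr rfl fun β hβ => ?_
  have : 0 ≤ ⌊S.coroot β (g x₀)⌋ := Int.floor_nonneg.2 (hdom β hβ).le
  rw [Int.card_Icc]
  omega

lemma Wone_subset_Wplus : S.Wone ⊆ S.Wplus :=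
  fun _ hg => ⟨hg.1, fun x hx α hα => (hg.2 x hx α hα).1⟩

end Ctx

/-- `ℓ((s_α w̃₂)^⋄) = ℓ(w̃₂) + Σ_{β∈R⁺} ⟨ω,β∨⟩ − 1`, where
`(s_α w̃₂)^⋄ = t_ω s_α w̃₂ ∈ W̃₁`. -/
theorem statement4 {V : Type} [AddCommGroup V] [Module ℝ V] [FiniteDimensional ℝ V]
    (S : Ctx V)
    (w₂ : V ≃ᵃ[ℝ] V) (hw₂ : w₂ ∈ S.Wone)
    (α : V) (hα : α ∈ S.Δ)
    (sα : V ≃ₗ[ℝ] V) (hsα : ∀ x, sα x = x - S.coroot α x • α)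
    (ω : V) (hω : ω ∈ S.X)
    (hdia : S.trans ω * (S.ofW sα * w₂) ∈ S.Wone) :
    (S.len (S.trans ω * (S.ofW sα * w₂)) : ℝ)
      = (S.len w₂ : ℝ) + (∑ β ∈ S.Rpos, S.coroot β ω) - 1 := by
  obtain ⟨x₀, hx₀⟩ := S.A0_nonempty
  have hαR := S.simple_mem_R hα
  have hαP := S.simple_subset hα
  set g := S.trans ω * (S.ofW sα * w₂)
  have hg := S.len_eq_sum_floor (S.Wone_subset_Wplus hdia) hx₀
  have h2 := S.len_eq_sum_floor (S.Wone_subset_Wplus hw₂) hx₀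
  have hgx : g x₀ = ω + sα (w₂ x₀) := rfl
  have hfloor : ∀ β ∈ S.R, (⌊S.coroot β (g x₀)⌋ : ℝ) =
      S.coroot β ω + ⌊S.coroot (β - S.coroot α β • α) (w₂ x₀)⌋ := by
    intro β hβ
    obtain ⟨m, hm⟩ := S.coroot_int β hβ ω hω
    have hval : S.coroot β (g x₀) = m + S.coroot (β - S.coroot α β • α) (w₂ x₀) := by
      rw [hgx, hsα, S.reflect_coroot α hαR β hβ, ← hm, map_add, map_sub, map_smul, smul_eq_mul,
        mul_comm (S.coroot α (w₂ x₀))]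
    rw [hval, Int.floor_intCast_add, hm]
    push_cast
    rfl
  have hneg : ⌊S.coroot (α - S.coroot α α • α) (w₂ x₀)⌋ = -1 := by
    have hb := hw₂.2 x₀ hx₀ α hα
    rw [S.reflect_coroot α hαR α hαR, S.coroot_self α hαR, Int.floor_eq_iff]
    push_cast
    constructor <;> linarith
  have hzero : ⌊S.coroot α (w₂ x₀)⌋ = 0 := by
    have hb := hw₂.2 x₀ hx₀ α hα
    exact Int.floor_eq_zero_iff.2 ⟨hb.1.le, hb.2⟩
  have hne : ∀ β ∈ S.Rpos.erase α, β - S.coroot α β • α ∈ S.Rpos.erase α := by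
    intro β hβ
    obtain ⟨hβα, hβP⟩ := Finset.mem_erase.1 hβ
    refine Finset.mem_erase.2 ⟨fun h => ?_, S.reflect_mem_Rpos hα hβP hβα⟩
    have h1 := S.reflect_reflect hαR β
    rw [h, S.coroot_self α hαR] at h1
    have h3 : -α = β := by rw [← h1]; module
    exact S.pos_not_neg α hαP (h3 ▸ hβP)
  have hperm : ∑ β ∈ S.Rpos.erase α, (⌊S.coroot (β - S.coroot α β • α) (w₂ x₀)⌋ : ℝ) =
      ∑ β ∈ S.Rpos.erase α, (⌊S.coroot β (w₂ x₀)⌋ : ℝ) :=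
    Finset.sum_bij' (fun β _ => β - S.coroot α β • α) (fun β _ => β - S.coroot α β • α)
      hne hne (fun β _ => S.reflect_reflect hαR β) (fun β _ => S.reflect_reflect hαR β)
      fun _ _ => rfl
  have hgR : (S.len g : ℝ) = ∑ β ∈ S.Rpos, (⌊S.coroot β (g x₀)⌋ : ℝ) := by exact_mod_cast hg
  have h2R : (S.len w₂ : ℝ) = ∑ β ∈ S.Rpos, (⌊S.coroot β (w₂ x₀)⌋ : ℝ) := by exact_mod_cast h2
  rw [hgR, h2R, Finset.sum_congr rfl fun β hβ => hfloor β (S.pos_subset hβ),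
    Finset.sum_add_distrib,
    ← Finset.add_sum_erase _ (fun β => (⌊S.coroot (β - S.coroot α β • α) (w₂ x₀)⌋ : ℝ)) hαP,
    ← Finset.add_sum_erase _ (fun β => (⌊S.coroot β (w₂ x₀)⌋ : ℝ)) hαP, hperm, hneg, hzero]
  push_cast
  ring

end SerrePaper
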